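/- Let N = 3, so that z_{μ,y}(x) = 3^{1/4}(μ/(μ² + |x−y|²))^{1/2}. Then ∫_{ℝ³} |∇(z_{μ,y} − z_{1,0})(x)|² dx → 2 ∫_{ℝ³} |∇z_{1,0}(x)|² dx as μ + μ^{−1} + |y| → ∞; that is, for every ε > 0 there exists R > 0 such that for all μ > 0 and y ∈ ℝ³ with μ + μ^{−1} + |y| ≥ R one has | ∫_{ℝ³} |∇(z_{μ,y} − z_{1,0})|² − 2∫_{ℝ³} |∇z_{1,0}|² | < ε. -/

import Mathlib

open MeasureTheory

/-- The standard bubble `z_{μ,y}` (for `N = 3`, `z_{μ,y}(x) = 3^{1/4}(μ/(μ²+|x−y|²))^{1/2}`). -/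
noncomputable def bubble (N : ℕ) (μ : ℝ) (y x : EuclideanSpace ℝ (Fin N)) : ℝ :=
  ((N : ℝ) * ((N : ℝ) - 2)) ^ (((N : ℝ) - 2) / 4) *
    (μ / (μ ^ 2 + ‖x - y‖ ^ 2)) ^ (((N : ℝ) - 2) / 2)

/-- The gradient of the three-dimensional bubble `z_{μ,y}`. -/
noncomputable def bubbleGrad (μ : ℝ) (y x : EuclideanSpace ℝ (Fin 3)) : EuclideanSpace ℝ (Fin 3) :=
  (-((3 : ℝ) ^ (1 / 4 : ℝ) * √μ * (μ ^ 2 + ‖x - y‖ ^ 2) ^ (-(3 / 2) : ℝ))) • (x - y)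

theorem bubble_three_eq {μ : ℝ} (hμ : 0 < μ) (y x : EuclideanSpace ℝ (Fin 3)) :
    bubble 3 μ y x =
      (3 : ℝ) ^ (1 / 4 : ℝ) * √μ * (μ ^ 2 + ‖x - y‖ ^ 2) ^ (-(1 / 2) : ℝ) := by
  have h : 0 < μ ^ 2 + ‖x - y‖ ^ 2 := by positivity
  unfold bubble
  rw [Real.div_rpow hμ.le h.le, Real.sqrt_eq_rpow, Real.rpow_neg h.le]
  norm_num
  ring

theorem hasGradientAt_bubble {μ : ℝ} (hμ : 0 < μ) (y x : EuclideanSpace ℝ (Fin 3)) :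
    HasGradientAt (bubble 3 μ y) (bubbleGrad μ y x) x := by
  have h : 0 < μ ^ 2 + ‖x - y‖ ^ 2 := by positivity
  rw [hasGradientAt_iff_hasFDerivAt, funext (bubble_three_eq hμ y)]
  have h1 := ((((hasFDerivAt_id x).sub_const y).norm_sq).const_add (μ ^ 2))
  have h2 := (h1.rpow_const (p := (-(1 / 2) : ℝ)) (Or.inl h.ne')).const_mul
    ((3 : ℝ) ^ (1 / 4 : ℝ) * √μ)
  refine h2.congr_fderiv ?_
  ext v
  simp only [bubbleGrad, map_smul, id]
  norm_num [inner_smul_left]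
  ring

theorem continuous_bubbleGrad {μ : ℝ} (hμ : 0 < μ) (y : EuclideanSpace ℝ (Fin 3)) :
    Continuous (bubbleGrad μ y) := by
  have h : Continuous fun x => (μ ^ 2 + ‖x - y‖ ^ 2) ^ (-(3 / 2) : ℝ) :=
    Continuous.rpow_const (by fun_prop) fun x => Or.inl (by positivity)
  unfold bubbleGrad
  fun_prop

/-- Bubbles are rescaled translates of `z_{1,0}`, at the level of gradients. -/
theorem bubbleGrad_add_smul {μ ν : ℝ} (hμ : 0 < μ) (hν : 0 < ν)
    (y w x : EuclideanSpace ℝ (Fin 3)) :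
    bubbleGrad (ν * μ) (y + ν • w) (y + ν • x) = ν ^ (-(3 / 2) : ℝ) • bubbleGrad μ w x := by
  have h : 0 < μ ^ 2 + ‖x - w‖ ^ 2 := by positivity
  have e : y + ν • x - (y + ν • w) = ν • (x - w) := by rw [smul_sub]; abel
  have e2 : (ν * μ) ^ 2 + (ν * ‖x - w‖) ^ 2 = ν ^ (2 : ℝ) * (μ ^ 2 + ‖x - w‖ ^ 2) := by
    rw [Real.rpow_two]; ring
  have e3 : (ν ^ (1 / 2 : ℝ)) * ν ^ (2 * -(3 / 2) : ℝ) * ν = ν ^ (-(3 / 2) : ℝ) := by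
    conv_lhs => rw [← Real.rpow_add hν, ← Real.rpow_add_one hν.ne']
    norm_num
  unfold bubbleGrad
  rw [e, norm_smul, Real.norm_of_nonneg hν.le, e2, Real.mul_rpow (by positivity) h.le,
    ← Real.rpow_mul hν.le, smul_smul, smul_smul, ← e3, Real.sqrt_mul hν.le, Real.sqrt_eq_rpow ν]
  congr 1
  ring

theorem norm_bubbleGrad_le {μ : ℝ} (hμ : 0 < μ) (y x : EuclideanSpace ℝ (Fin 3)) :
    ‖bubbleGrad μ y x‖ ≤ (3 : ℝ) ^ (1 / 4 : ℝ) * (√μ / (μ ^ 2 + ‖x - y‖ ^ 2)) := by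
  have h : 0 < μ ^ 2 + ‖x - y‖ ^ 2 := by positivity
  have h1 : ‖x - y‖ ≤ (μ ^ 2 + ‖x - y‖ ^ 2) ^ (1 / 2 : ℝ) := by
    rw [← Real.sqrt_eq_rpow]
    exact Real.le_sqrt_of_sq_le (by nlinarith)
  have h2 : (μ ^ 2 + ‖x - y‖ ^ 2) ^ (-(3 / 2) : ℝ) * (μ ^ 2 + ‖x - y‖ ^ 2) ^ (1 / 2 : ℝ) =
      (μ ^ 2 + ‖x - y‖ ^ 2)⁻¹ := by
    rw [← Real.rpow_add h, ← Real.rpow_neg_one]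
    norm_num
  unfold bubbleGrad
  rw [norm_smul, norm_neg, Real.norm_of_nonneg (by positivity), div_eq_mul_inv √μ, ← h2]
  calc _ ≤ (3 : ℝ) ^ (1 / 4 : ℝ) * √μ * (μ ^ 2 + ‖x - y‖ ^ 2) ^ (-(3 / 2) : ℝ) *
        (μ ^ 2 + ‖x - y‖ ^ 2) ^ (1 / 2 : ℝ) := by gcongr
    _ = _ := by ring

theorem integral_comp_add_smul {ν : ℝ} (hν : 0 < ν) (y : EuclideanSpace ℝ (Fin 3))
    (f : EuclideanSpace ℝ (Fin 3) → ℝ) :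
    ∫ x, f x = ν ^ 3 * ∫ x, f (y + ν • x) := by
  rw [Measure.integral_comp_smul volume (fun x => f (y + x)) ν, integral_add_left_eq_self f y]
  simp only [finrank_euclideanSpace, Fintype.card_fin, smul_eq_mul]
  rw [abs_of_pos (by positivity), mul_inv_cancel_left₀ (by positivity)]

theorem integrable_one_add_norm_sq_rpow :
    Integrable fun x : EuclideanSpace ℝ (Fin 3) => (1 + ‖x‖ ^ 2) ^ (-(25 / 16) : ℝ) := by
  have h := integrable_rpow_neg_one_add_norm_sq (E := EuclideanSpace ℝ (Fin 3))
    (μ := volume) (r := 25 / 8) (by norm_num)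
  norm_num at h ⊢
  exact h

theorem integrable_norm_bubbleGrad_one_sq :
    Integrable fun x => ‖bubbleGrad 1 0 x‖ ^ 2 := by
  refine (integrable_one_add_norm_sq_rpow.const_mul (((3 : ℝ) ^ (1 / 4 : ℝ)) ^ 2)).mono'
    ((continuous_bubbleGrad one_pos 0).norm.pow 2).aestronglyMeasurable (.of_forall fun x => ?_)
  have h1 : 1 ≤ 1 + ‖x‖ ^ 2 := by nlinarith [sq_nonneg ‖x‖]
  have h := norm_bubbleGrad_le one_pos 0 x
  simp only [Real.sqrt_one, one_pow, sub_zero] at h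
  rw [Real.norm_of_nonneg (by positivity)]
  calc ‖bubbleGrad 1 0 x‖ ^ 2 ≤ ((3 : ℝ) ^ (1 / 4 : ℝ) * (1 / (1 + ‖x‖ ^ 2))) ^ 2 := by gcongr
    _ = ((3 : ℝ) ^ (1 / 4 : ℝ)) ^ 2 * (1 + ‖x‖ ^ 2) ^ (-2 : ℝ) := by
      rw [Real.rpow_neg (by positivity), Real.rpow_two, mul_pow, one_div (1 + ‖x‖ ^ 2), inv_pow]
    _ ≤ _ := by gcongr; norm_num

theorem norm_bubbleGrad_add_smul_sq {μ : ℝ} (hμ : 0 < μ) (y x : EuclideanSpace ℝ (Fin 3)) :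
    ‖bubbleGrad μ y (y + μ • x)‖ ^ 2 = (μ ^ 3)⁻¹ * ‖bubbleGrad 1 0 x‖ ^ 2 := by
  have h := bubbleGrad_add_smul one_pos hμ y 0 x
  rw [mul_one, smul_zero, add_zero] at h
  rw [h, norm_smul, mul_pow, Real.norm_of_nonneg (by positivity), ← Real.rpow_mul_natCast hμ.le,
    ← Real.rpow_natCast μ 3, ← Real.rpow_neg hμ.le]
  norm_num

theorem integrable_norm_bubbleGrad_sq {μ : ℝ} (hμ : 0 < μ) (y : EuclideanSpace ℝ (Fin 3)) :
    Integrable fun x => ‖bubbleGrad μ y x‖ ^ 2 := by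
  have h := ((integrable_norm_bubbleGrad_one_sq.comp_smul
    (inv_ne_zero hμ.ne')).comp_sub_right y).const_mul (μ ^ 3)⁻¹
  refine h.congr (.of_forall fun x => ?_)
  simp only
  rw [← norm_bubbleGrad_add_smul_sq hμ y, smul_inv_smul₀ hμ.ne', add_sub_cancel]

theorem integral_norm_bubbleGrad_sq {μ : ℝ} (hμ : 0 < μ) (y : EuclideanSpace ℝ (Fin 3)) :
    ∫ x, ‖bubbleGrad μ y x‖ ^ 2 = ∫ x, ‖bubbleGrad 1 0 x‖ ^ 2 := by
  rw [integral_comp_add_smul hμ y]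
  simp only [norm_bubbleGrad_add_smul_sq hμ]
  rw [integral_const_mul, mul_inv_cancel_left₀ (by positivity)]

/-- The interaction term is invariant under exchanging the two bubbles and rescaling. -/
theorem integral_inner_bubbleGrad_inv {μ : ℝ} (hμ : 0 < μ) (y : EuclideanSpace ℝ (Fin 3)) :
    ∫ x, inner ℝ (bubbleGrad μ y x) (bubbleGrad 1 0 x) =
      ∫ x, inner ℝ (bubbleGrad μ⁻¹ (-(μ⁻¹ • y)) x) (bubbleGrad 1 0 x) := by
  rw [integral_comp_add_smul hμ y, ← integral_const_mul]
  congr 1 with x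
  have h1 := bubbleGrad_add_smul one_pos hμ y 0 x
  have h2 := bubbleGrad_add_smul (inv_pos.2 hμ) hμ y (-(μ⁻¹ • y)) x
  rw [mul_one, smul_zero, add_zero] at h1
  rw [mul_inv_cancel₀ hμ.ne', smul_neg, smul_inv_smul₀ hμ.ne', add_neg_cancel] at h2
  have h3 : μ ^ 3 * (μ ^ (-(3 / 2) : ℝ) * μ ^ (-(3 / 2) : ℝ)) = 1 := by
    rw [← Real.rpow_add hμ, ← Real.rpow_natCast, ← Real.rpow_add hμ]
    norm_num
  rw [h1, h2, real_inner_smul_left, real_inner_smul_right, ← mul_assoc _ _ (inner _ _ _),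
    ← mul_assoc, h3, one_mul, real_inner_comm]

theorem rpow_mul_rpow_le_add_rpow {a b s t : ℝ} (ha : 0 < a) (hb : 0 < b) (hs : 0 ≤ s)
    (ht : 0 ≤ t) : a ^ (-s) * b ^ (-t) ≤ a ^ (-(s + t)) + b ^ (-(s + t)) := by
  have ha' := Real.rpow_pos_of_pos ha (-(s + t))
  have hb' := Real.rpow_pos_of_pos hb (-(s + t))
  rcases le_total a b with h | h
  · calc a ^ (-s) * b ^ (-t) ≤ a ^ (-s) * a ^ (-t) := by
          gcongr ?_ * ?_
          exact Real.rpow_le_rpow_of_nonpos ha h (by linarith)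
      _ = a ^ (-(s + t)) := by rw [← Real.rpow_add ha]; ring_nf
      _ ≤ _ := by linarith
  · calc a ^ (-s) * b ^ (-t) ≤ b ^ (-s) * b ^ (-t) := by
          gcongr ?_ * ?_
          exact Real.rpow_le_rpow_of_nonpos hb h (by linarith)
      _ = b ^ (-(s + t)) := by rw [← Real.rpow_add hb]; ring_nf
      _ ≤ _ := by linarith

/-- Separation of two concentration profiles, with a gain in the parameters. -/
theorem sqrt_div_mul_inv_le {μ a b m Y : ℝ} (hμ : 1 ≤ μ) (ha : 1 ≤ a) (hb : 1 ≤ b)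
    (hbm : b ≤ m) (hμm : μ ^ 2 ≤ m) (hY : 0 < Y) (hYab : Y ≤ a * b) :
    √μ / m * a⁻¹ ≤ (μ ^ 8 * Y) ^ (-(1 / 32) : ℝ) *
      (a ^ (-(25 / 16) : ℝ) + b ^ (-(25 / 16) : ℝ)) := by
  have hμ0 : 0 < μ := by linarith
  have ha0 : 0 < a := by linarith
  have hb0 : 0 < b := by linarith
  have hm0 : 0 < m := by linarith
  have h1 : m⁻¹ ≤ μ ^ (-(3 / 4) : ℝ) * b ^ (-(5 / 8) : ℝ) := by
    calc m⁻¹ = m ^ (-(3 / 8) : ℝ) * m ^ (-(5 / 8) : ℝ) := by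
          rw [← Real.rpow_add hm0, ← Real.rpow_neg_one]; norm_num
      _ ≤ (μ ^ 2) ^ (-(3 / 8) : ℝ) * b ^ (-(5 / 8) : ℝ) := by
          gcongr ?_ * ?_
          · exact Real.rpow_le_rpow_of_nonpos (by positivity) hμm (by norm_num)
          · exact Real.rpow_le_rpow_of_nonpos hb0 hbm (by norm_num)
      _ = _ := by
          rw [← Real.rpow_two, ← Real.rpow_mul hμ0.le]; norm_num
  have h2 : a⁻¹ * b ^ (-(5 / 8) : ℝ) =
      (a * b) ^ (-(1 / 32) : ℝ) * (a ^ (-(31 / 32) : ℝ) * b ^ (-(19 / 32) : ℝ)) := by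
    rw [Real.mul_rpow ha0.le hb0.le, mul_mul_mul_comm, ← Real.rpow_add ha0, ← Real.rpow_add hb0,
      ← Real.rpow_neg_one]
    norm_num
  have h3 : a ^ (-(31 / 32) : ℝ) * b ^ (-(19 / 32) : ℝ) ≤
      a ^ (-(25 / 16) : ℝ) + b ^ (-(25 / 16) : ℝ) := by
    have h := rpow_mul_rpow_le_add_rpow (s := 31 / 32) (t := 19 / 32) ha0 hb0
      (by norm_num) (by norm_num)
    norm_num at h ⊢
    exact h
  have h4 : √μ * μ ^ (-(3 / 4) : ℝ) = (μ ^ 8) ^ (-(1 / 32) : ℝ) := by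
    rw [Real.sqrt_eq_rpow, ← Real.rpow_add hμ0, ← Real.rpow_natCast, ← Real.rpow_mul hμ0.le]
    norm_num
  calc √μ / m * a⁻¹ = √μ * m⁻¹ * a⁻¹ := by rw [div_eq_mul_inv]
    _ ≤ √μ * (μ ^ (-(3 / 4) : ℝ) * b ^ (-(5 / 8) : ℝ)) * a⁻¹ := by gcongr
    _ = (√μ * μ ^ (-(3 / 4) : ℝ)) * (a⁻¹ * b ^ (-(5 / 8) : ℝ)) := by ring
    _ ≤ (μ ^ 8) ^ (-(1 / 32) : ℝ) * (Y ^ (-(1 / 32) : ℝ) *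
        (a ^ (-(25 / 16) : ℝ) + b ^ (-(25 / 16) : ℝ))) := by
      rw [h2, h4]
      gcongr ?_ * (?_ * ?_)
      exact Real.rpow_le_rpow_of_nonpos hY hYab (by norm_num)
    _ = _ := by rw [Real.mul_rpow (by positivity) hY.le, mul_assoc]

theorem abs_integral_inner_bubbleGrad_le_of_one_le {μ : ℝ} (hμ : 1 ≤ μ)
    (y : EuclideanSpace ℝ (Fin 3)) :
    |∫ x, inner ℝ (bubbleGrad μ y x) (bubbleGrad 1 0 x)| ≤
      ((3 : ℝ) ^ (1 / 4 : ℝ)) ^ 2 * (μ ^ 8 * ((1 + ‖y‖ ^ 2) / 2)) ^ (-(1 / 32) : ℝ) *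
        (2 * ∫ x : EuclideanSpace ℝ (Fin 3), (1 + ‖x‖ ^ 2) ^ (-(25 / 16) : ℝ)) := by
  have hμ0 : 0 < μ := by linarith
  have hi := integrable_one_add_norm_sq_rpow
  have hj := hi.comp_sub_right y
  have hint : 2 * ∫ x : EuclideanSpace ℝ (Fin 3), (1 + ‖x‖ ^ 2) ^ (-(25 / 16) : ℝ) =
      ∫ x : EuclideanSpace ℝ (Fin 3),
        ((1 + ‖x‖ ^ 2) ^ (-(25 / 16) : ℝ) + (1 + ‖x - y‖ ^ 2) ^ (-(25 / 16) : ℝ)) := by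
    rw [integral_add hi hj, integral_sub_right_eq_self
      (fun x : EuclideanSpace ℝ (Fin 3) => (1 + ‖x‖ ^ 2) ^ (-(25 / 16) : ℝ)) y, two_mul]
  rw [hint, ← integral_const_mul, ← Real.norm_eq_abs]
  refine norm_integral_le_of_norm_le ((hi.add hj).const_mul _) (.of_forall fun x => ?_)
  have hx : ‖y‖ ≤ ‖x‖ + ‖x - y‖ := by
    rw [add_comm, ← norm_sub_rev y x]; simpa using norm_add_le (y - x) x
  have hY : (1 + ‖y‖ ^ 2) / 2 ≤ (1 + ‖x‖ ^ 2) * (1 + ‖x - y‖ ^ 2) := by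
    have := pow_le_pow_left₀ (norm_nonneg y) hx 2
    nlinarith [sq_nonneg (‖x‖ - ‖x - y‖), mul_nonneg (sq_nonneg ‖x‖) (sq_nonneg ‖x - y‖)]
  have h1 := norm_bubbleGrad_le hμ0 y x
  have h2 := norm_bubbleGrad_le one_pos 0 x
  simp only [Real.sqrt_one, one_pow, sub_zero] at h2
  have h3 := sqrt_div_mul_inv_le (a := 1 + ‖x‖ ^ 2) (b := 1 + ‖x - y‖ ^ 2)
    (m := μ ^ 2 + ‖x - y‖ ^ 2) hμ (by nlinarith [sq_nonneg ‖x‖])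
    (by nlinarith [sq_nonneg ‖x - y‖]) (by nlinarith) (by nlinarith [sq_nonneg ‖x - y‖])
    (by positivity) hY
  calc ‖inner ℝ (bubbleGrad μ y x) (bubbleGrad 1 0 x)‖
      ≤ ‖bubbleGrad μ y x‖ * ‖bubbleGrad 1 0 x‖ := norm_inner_le_norm _ _
    _ ≤ (3 : ℝ) ^ (1 / 4 : ℝ) * (√μ / (μ ^ 2 + ‖x - y‖ ^ 2)) *
        ((3 : ℝ) ^ (1 / 4 : ℝ) * (1 / (1 + ‖x‖ ^ 2))) := by gcongr
    _ = ((3 : ℝ) ^ (1 / 4 : ℝ)) ^ 2 *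
        (√μ / (μ ^ 2 + ‖x - y‖ ^ 2) * (1 + ‖x‖ ^ 2)⁻¹) := by ring
    _ ≤ _ := by
      rw [mul_assoc]
      gcongr

theorem exists_abs_integral_inner_bubbleGrad_le :
    ∃ C > (0 : ℝ), ∀ (μ : ℝ) (y : EuclideanSpace ℝ (Fin 3)), 0 < μ →
      |∫ x, inner ℝ (bubbleGrad μ y x) (bubbleGrad 1 0 x)| ≤
        C * ((μ + μ⁻¹ + ‖y‖) / 12) ^ (-(1 / 32) : ℝ) := by
  set A := ∫ x : EuclideanSpace ℝ (Fin 3), (1 + ‖x‖ ^ 2) ^ (-(25 / 16) : ℝ)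
  have hA0 : 0 ≤ A := integral_nonneg fun x => by positivity
  have key : ∀ (μ : ℝ) (y : EuclideanSpace ℝ (Fin 3)) (S : ℝ), 1 ≤ μ → 0 < S →
      S ≤ μ + μ⁻¹ + ‖y‖ → |∫ x, inner ℝ (bubbleGrad μ y x) (bubbleGrad 1 0 x)| ≤
        (((3 : ℝ) ^ (1 / 4 : ℝ)) ^ 2 * (2 * A) + 1) * (S / 12) ^ (-(1 / 32) : ℝ) := by
    intro μ y S hμ hS hle
    have hS12 : S / 12 ≤ μ ^ 8 * ((1 + ‖y‖ ^ 2) / 2) := by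
      have h1 : μ⁻¹ ≤ 1 := inv_le_one_of_one_le₀ hμ
      have h2 : μ ≤ μ ^ 8 := le_self_pow₀ hμ (by norm_num)
      have h3 : 1 ≤ μ ^ 8 := hμ.trans h2
      nlinarith [sq_nonneg (‖y‖ - 1), mul_nonneg (sub_nonneg.2 h3) (sq_nonneg ‖y‖)]
    have h4 := Real.rpow_le_rpow_of_nonpos (z := -(1 / 32)) (by positivity) hS12 (by norm_num)
    calc _ ≤ _ := abs_integral_inner_bubbleGrad_le_of_one_le hμ y
      _ ≤ ((3 : ℝ) ^ (1 / 4 : ℝ)) ^ 2 * (S / 12) ^ (-(1 / 32) : ℝ) * (2 * A) := by gcongr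
      _ = (((3 : ℝ) ^ (1 / 4 : ℝ)) ^ 2 * (2 * A)) * (S / 12) ^ (-(1 / 32) : ℝ) := by ring
      _ ≤ _ := by gcongr; linarith
  refine ⟨((3 : ℝ) ^ (1 / 4 : ℝ)) ^ 2 * (2 * A) + 1, by positivity, fun μ y hμ => ?_⟩
  have hμ' := inv_pos.2 hμ
  rcases le_total 1 μ with h | h
  · exact key μ y _ h (by positivity) le_rfl
  · rw [integral_inner_bubbleGrad_inv hμ y]
    have h1 := one_le_inv₀ hμ |>.2 h
    refine key _ _ _ h1 (by positivity) ?_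
    rw [norm_neg, norm_smul, inv_inv, Real.norm_of_nonneg hμ'.le]
    nlinarith [norm_nonneg y]

theorem integral_norm_bubbleGrad_sub_sq {μ : ℝ} (hμ : 0 < μ) (y : EuclideanSpace ℝ (Fin 3)) :
    ∫ x, ‖bubbleGrad μ y x - bubbleGrad 1 0 x‖ ^ 2 =
      2 * (∫ x, ‖bubbleGrad 1 0 x‖ ^ 2) -
        2 * ∫ x, inner ℝ (bubbleGrad μ y x) (bubbleGrad 1 0 x) := by
  have h1 := integrable_norm_bubbleGrad_sq hμ y
  have h2 := integrable_norm_bubbleGrad_one_sq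
  have h3 : Integrable fun x => inner ℝ (bubbleGrad μ y x) (bubbleGrad 1 0 x) := by
    refine (h1.add h2).mono' ((continuous_bubbleGrad hμ y).inner
      (continuous_bubbleGrad one_pos 0)).aestronglyMeasurable (.of_forall fun x => ?_)
    refine (norm_inner_le_norm _ _).trans ?_
    simp only [Pi.add_apply]
    nlinarith [sq_nonneg (‖bubbleGrad μ y x‖ - ‖bubbleGrad 1 0 x‖),
      sq_nonneg (‖bubbleGrad μ y x‖ + ‖bubbleGrad 1 0 x‖)]
  simp only [norm_sub_sq_real]
  have h4 : Integrable fun x => ‖bubbleGrad μ y x‖ ^ 2 -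
      2 * inner ℝ (bubbleGrad μ y x) (bubbleGrad 1 0 x) := h1.sub (h3.const_mul 2)
  rw [integral_add h4 h2, integral_sub h1 (h3.const_mul 2),
    integral_norm_bubbleGrad_sq hμ, integral_const_mul]
  ring

theorem gradient_bubble_sub {μ : ℝ} (hμ : 0 < μ) (y x : EuclideanSpace ℝ (Fin 3)) :
    gradient (fun x => bubble 3 μ y x - bubble 3 1 0 x) x =
      bubbleGrad μ y x - bubbleGrad 1 0 x := by
  have h := (hasGradientAt_bubble hμ y x).hasFDerivAt.sub
    (hasGradientAt_bubble one_pos 0 x).hasFDerivAt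
  rw [← map_sub] at h
  exact HasGradientAt.gradient (hasGradientAt_iff_hasFDerivAt.2 h)

theorem stmt3 :
    ∀ ε > (0 : ℝ), ∃ R > (0 : ℝ), ∀ (μ : ℝ) (y : EuclideanSpace ℝ (Fin 3)),
      0 < μ → R ≤ μ + μ⁻¹ + ‖y‖ →
      |(∫ x, ‖gradient (fun x => bubble 3 μ y x - bubble 3 1 0 x) x‖ ^ 2) -
          2 * ∫ x, ‖gradient (bubble 3 1 0) x‖ ^ 2| < ε := by
  intro ε hε
  obtain ⟨C, hC, h⟩ := exists_abs_integral_inner_bubbleGrad_le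
  have ht := (tendsto_rpow_neg_atTop (y := 1 / 32) (by norm_num)).const_mul (2 * C)
  rw [mul_zero] at ht
  obtain ⟨R, hR⟩ := Filter.eventually_atTop.1
    ((ht.eventually_lt_const hε).and (Filter.eventually_gt_atTop (0 : ℝ)))
  have hR0 : 0 < R := (hR R le_rfl).2
  refine ⟨12 * R, by positivity, fun μ y hμ hle => ?_⟩
  simp only [gradient_bubble_sub hμ, (hasGradientAt_bubble one_pos 0 _).gradient]
  rw [integral_norm_bubbleGrad_sub_sq hμ, sub_sub_cancel_left, abs_neg, abs_mul, abs_two]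
  have h1 := h μ y hμ
  have h2 := (hR _ (show (μ + μ⁻¹ + ‖y‖) / 12 ≥ R by linarith)).1
  linarith
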